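/- There exists an absolute constant K such that the following holds for every sufficiently large prime p. Let A ⊆ 𝔽_p satisfy 2 ≤ |A| < √p. Then, with δ = 4/227, there exist disjoint subsets B and C of A with A = B ∪ C and max{E₊(B), E×(C)} ≤ K·|A|^(3−δ)·(log |A|)^(1+δ/2). -/

import Mathlib

open Finset

/-- Additive energy `E₊(B) = #{(b₁,b₂,b₃,b₄) ∈ B⁴ : b₁+b₂ = b₃+b₄}` in `𝔽_p`. -/
def addE {p : ℕ} (B : Finset (ZMod p)) : ℕ :=
  ((B ×ˢ B ×ˢ B ×ˢ B).filter fun x => x.1 + x.2.1 = x.2.2.1 + x.2.2.2).card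

/-- Multiplicative energy `E×(C) = #{(c₁,c₂,c₃,c₄) ∈ C⁴ : c₁c₂ = c₃c₄}` in `𝔽_p`. -/
def mulE {p : ℕ} (C : Finset (ZMod p)) : ℕ :=
  ((C ×ˢ C ×ˢ C ×ˢ C).filter fun x => x.1 * x.2.1 = x.2.2.1 * x.2.2.2).card


section Counting

variable {α β γ : Type*} [DecidableEq γ]

lemma card_filter_product_eq_sum [Fintype γ] (U : Finset α) (V : Finset β) (f : α → γ)
    (g : β → γ) :
    #((U ×ˢ V).filter fun x => f x.1 = g x.2) =
      ∑ i, #(U.filter fun u => f u = i) * #(V.filter fun v => g v = i) := by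
  rw [card_eq_sum_card_fiberwise (f := fun x => f x.1) (t := univ) (by simp)]
  refine sum_congr rfl fun i _ => ?_
  rw [← card_product]
  congr 1
  ext ⟨u, v⟩
  simp only [mem_filter, mem_product]
  grind

lemma card_sq_le_card_mul_card_collisions [Fintype γ] (U : Finset α) (f : α → γ)
    (I : Finset γ) (hI : ∀ u ∈ U, f u ∈ I) :
    #U ^ 2 ≤ #I * #((U ×ˢ U).filter fun x => f x.1 = f x.2) := by
  rw [card_filter_product_eq_sum, card_eq_sum_card_fiberwise (f := f) (t := I) hI]
  refine (sq_sum_le_card_mul_sum_sq (s := I)).trans ?_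
  simp_rw [sq]
  exact Nat.mul_le_mul_left _ (sum_le_sum_of_subset (subset_univ I))

end Counting

section Sumsets

open scoped Pointwise

variable {G : Type*} [AddCommGroup G] [DecidableEq G]

/-- A large-subset form of Petridis' lemma. -/
lemma exists_large_subset_card_add_add_le (X B : Finset G) (hB : B.Nonempty) :
    ∃ T ⊆ X, #X ≤ 2 * #T ∧ ∀ C : Finset G, #X * #(T + B + C) ≤ 2 * #(X + B) * #(T + C) := by
  obtain ⟨T, hT, hmin⟩ := exists_min_image X.powerset
    (fun T => (#X : ℤ) * #(T + B) - 2 * #(X + B) * #T) ⟨X, by simp⟩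
  simp only [mem_powerset] at hT hmin
  refine ⟨T, hT, ?_, fun C => ?_⟩
  · rcases X.eq_empty_or_nonempty with rfl | hX
    · simp
    have h := hmin X subset_rfl
    have hpos : (0 : ℤ) < #(X + B) := by exact_mod_cast (hX.add hB).card_pos
    have h2 : (0 : ℤ) ≤ #X * #(T + B) := by positivity
    zify
    nlinarith
  · induction C using Finset.induction_on with
    | empty => simp
    | insert c C hc ih =>
      set W := T.filter fun t => t + c ∈ T + C with hW
      have hWT : W ⊆ T := filter_subset _ _
      have h1 : #(T + B + insert c C) + #(W + B) ≤ #(T + B + C) + #(T + B) := by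
        have hsub : T + B + insert c C ⊆ (T + B + C) ∪ ((T + B) \ (W + B)).image (· + c) := by
          intro z hz
          obtain ⟨y, hy, d, hd, rfl⟩ := mem_add.1 hz
          rcases mem_insert.1 hd with rfl | hd
          · by_cases hyW : y ∈ W + B
            · obtain ⟨w, hw, b, hb, rfl⟩ := mem_add.1 hyW
              obtain ⟨t, ht, e, he, hte⟩ := mem_add.1 (mem_filter.1 hw).2
              refine mem_union_left _ (mem_add.2 ⟨t + b, add_mem_add ht hb, e, he, ?_⟩)
              rw [add_right_comm, hte, add_right_comm]
            · exact mem_union_right _ (mem_image_of_mem _ (mem_sdiff.2 ⟨hy, hyW⟩))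
          · exact mem_union_left _ (add_mem_add hy hd)
        have h := (card_le_card hsub).trans ((card_union_le _ _).trans
          (Nat.add_le_add_left card_image_le _))
        have := card_sdiff_add_card_eq_card (add_subset_add_right (t := B) hWT)
        lia
      have h2 : #(T + C) + #T ≤ #(T + insert c C) + #W := by
        have hdisj : Disjoint (T + C) ((T \ W).image (· + c)) := by
          rw [disjoint_right]
          intro z hz hz'
          obtain ⟨t, ht, rfl⟩ := mem_image.1 hz
          exact (mem_sdiff.1 ht).2 (mem_filter.2 ⟨(mem_sdiff.1 ht).1, hz'⟩)
        have hsub : (T + C) ∪ (T \ W).image (· + c) ⊆ T + insert c C := by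
          refine union_subset (add_subset_add_left (subset_insert _ _)) fun z hz => ?_
          obtain ⟨t, ht, rfl⟩ := mem_image.1 hz
          exact add_mem_add (mem_sdiff.1 ht).1 (mem_insert_self _ _)
        have h := card_le_card hsub
        rw [card_union_of_disjoint hdisj,
          card_image_of_injective _ (add_left_injective c)] at h
        have := card_sdiff_add_card_eq_card hWT
        lia
      have h3 := hmin W (hWT.trans hT)
      zify at h1 h2 ih ⊢
      nlinarith [Nat.cast_nonneg (α := ℤ) #X, Nat.cast_nonneg (α := ℤ) #(X + B)]

end Sumsets


section BalogSzemerediGowers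

open scoped Pointwise

variable {p : ℕ}

/-- The number of representations of `d` as a difference of two elements of `A`. -/
def diffRep (A : Finset (ZMod p)) (d : ZMod p) : ℕ :=
  #((A ×ˢ A).filter fun x => x.1 - x.2 = d)

lemma sum_diffRep [NeZero p] (A : Finset (ZMod p)) : ∑ d, diffRep A d = #A ^ 2 := by
  rw [sq, ← card_product]
  exact (card_eq_sum_card_fiberwise (by simp)).symm

lemma addE_eq_sum_diffRep_sq [NeZero p] (A : Finset (ZMod p)) : addE A = ∑ d, diffRep A d ^ 2 := by
  simp_rw [sq]
  unfold diffRep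
  rw [← card_filter_product_eq_sum (A ×ˢ A) (A ×ˢ A) (fun x => x.1 - x.2) (fun x => x.1 - x.2)]
  refine card_nbij' (fun x => ((x.1, x.2.2.1), (x.2.2.2, x.2.1)))
    (fun x => (x.1.1, x.2.2, x.1.2, x.2.1)) ?_ ?_ ?_ ?_
  · rintro ⟨a, b, c, d⟩ h
    simp only [coe_filter, mem_product, Set.mem_ofPred_eq] at h ⊢
    refine ⟨by tauto, ?_⟩
    linear_combination h.2
  · rintro ⟨⟨a, b⟩, c, d⟩ h
    simp only [coe_filter, mem_product, Set.mem_ofPred_eq] at h ⊢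
    refine ⟨by tauto, ?_⟩
    linear_combination h.2
  · intro x _
    rfl
  · intro x _
    rfl

lemma card_filter_sub_mem (A : Finset (ZMod p)) (s : ZMod p) :
    #(A.filter fun a => a - s ∈ A) = diffRep A s := by
  refine card_nbij' (fun a => (a, a - s)) Prod.fst ?_ ?_ ?_ ?_
  · intro a ha
    simp_all
  · rintro ⟨a, b⟩ h
    simp only [coe_filter, mem_product, Set.mem_ofPred_eq] at h ⊢
    obtain ⟨⟨ha, hb⟩, rfl⟩ := h
    simpa using ⟨ha, hb⟩
  · intro a _
    rfl
  · rintro ⟨a, b⟩ h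
    simp only [coe_filter, mem_product, Set.mem_ofPred_eq] at h
    simp [← h.2]

/-- Pairs of elements of `A ∩ (A + s)` whose difference satisfies `Q`, summed over `s`. -/
lemma sum_card_filter_diff_le [NeZero p] (A : Finset (ZMod p)) (Q : ZMod p → Prop) [DecidablePred Q] :
    ∑ s, #(((A.filter fun a => a - s ∈ A) ×ˢ (A.filter fun a => a - s ∈ A)).filter
        fun x => Q (x.1 - x.2)) ≤
      ∑ x ∈ (A ×ˢ A).filter (fun x => Q (x.1 - x.2)), diffRep A (x.1 - x.2) := by
  have h (s : ZMod p) : #(((A.filter fun a => a - s ∈ A) ×ˢ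
      (A.filter fun a => a - s ∈ A)).filter fun x => Q (x.1 - x.2)) =
      ∑ x ∈ (A ×ˢ A).filter (fun x => Q (x.1 - x.2)),
        if x.1 - s ∈ A ∧ x.2 - s ∈ A then 1 else 0 := by
    rw [← card_filter, filter_filter]
    congr 1
    ext x
    simp only [mem_filter, mem_product]
    tauto
  simp_rw [h]
  rw [sum_comm]
  refine sum_le_sum fun x _ => ?_
  rw [← card_filter]
  refine card_le_card_of_injOn (fun s => (x.1 - s, x.2 - s)) ?_ ?_
  · intro s hs
    simpa using hs
  · intro s _ t _ hst
    simpa using hst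

lemma exists_popular_intersection [NeZero p] (A : Finset (ZMod p)) (hE : 0 < addE A) :
    ∃ s, addE A ≤ 2 * #A ^ 2 * diffRep A s ∧
      8 * #(((A.filter fun a => a - s ∈ A) ×ˢ (A.filter fun a => a - s ∈ A)).filter
        fun x => 32 * #A ^ 2 * diffRep A (x.1 - x.2) < addE A) ≤ diffRep A s ^ 2 := by
  by_contra! hcon
  set bad : ZMod p → ℕ := fun s => #(((A.filter fun a => a - s ∈ A) ×ˢ
    (A.filter fun a => a - s ∈ A)).filter
      fun x => 32 * #A ^ 2 * diffRep A (x.1 - x.2) < addE A) with hbad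
  have hA : 0 < #A ^ 2 := by
    rw [← sum_diffRep]
    by_contra! h
    have h' : ∀ d, diffRep A d = 0 := by simpa using h
    simp [addE_eq_sum_diffRep_sq, h'] at hE
  have h1 : 32 * ∑ s, bad s ≤ addE A := by
    refine Nat.le_of_mul_le_mul_left ?_ hA
    calc #A ^ 2 * (32 * ∑ s, bad s) = 32 * #A ^ 2 * ∑ s, bad s := by ring
      _ ≤ 32 * #A ^ 2 * ∑ x ∈ (A ×ˢ A).filter
          (fun x => 32 * #A ^ 2 * diffRep A (x.1 - x.2) < addE A), diffRep A (x.1 - x.2) := by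
        gcongr
        exact sum_card_filter_diff_le A fun d => 32 * #A ^ 2 * diffRep A d < addE A
      _ ≤ ∑ x ∈ (A ×ˢ A).filter
          (fun x => 32 * #A ^ 2 * diffRep A (x.1 - x.2) < addE A), addE A := by
        rw [mul_sum]
        exact sum_le_sum fun x hx => (mem_filter.1 hx).2.le
      _ ≤ #A ^ 2 * addE A := by
        rw [sum_const, smul_eq_mul]
        gcongr
        exact (card_filter_le _ _).trans (by rw [card_product, sq])
  have h2 : ∀ s, 2 * #A ^ 2 * diffRep A s ^ 2 ≤
      addE A * diffRep A s + 16 * #A ^ 2 * bad s := by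
    intro s
    by_cases hs : addE A ≤ 2 * #A ^ 2 * diffRep A s
    · have h := (hcon s hs).le
      calc _ ≤ 2 * #A ^ 2 * (8 * bad s) := by gcongr
        _ = 16 * #A ^ 2 * bad s := by ring
        _ ≤ _ := by lia
    · calc _ = (2 * #A ^ 2 * diffRep A s) * diffRep A s := by ring
        _ ≤ addE A * diffRep A s := by gcongr; lia
        _ ≤ _ := by lia
  have h3 := sum_le_sum fun s (_ : s ∈ univ) => h2 s
  rw [← mul_sum, sum_add_distrib, ← mul_sum, ← mul_sum, ← addE_eq_sum_diffRep_sq,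
    sum_diffRep] at h3
  nlinarith

/-- The number of ways to write an element as `(x - y) - (z - w)` is at least a sum of products of
representation counts. -/
lemma sum_diffRep_mul_diffRep_le (A S : Finset (ZMod p)) (a a' : ZMod p) :
    ∑ b ∈ S, diffRep A (a - b) * diffRep A (a' - b) ≤
      #(((A ×ˢ A) ×ˢ (A ×ˢ A)).filter fun x => (x.1.1 - x.1.2) - (x.2.1 - x.2.2) = a - a') := by
  simp_rw [diffRep, ← card_product]
  rw [← card_biUnion]
  · refine card_le_card fun x hx => ?_
    simp only [mem_biUnion, mem_product, mem_filter] at hx ⊢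
    obtain ⟨b, -, ⟨h1, h2⟩, h3, h4⟩ := hx
    refine ⟨⟨h1, h3⟩, ?_⟩
    rw [h2, h4]
    ring
  · intro b _ b' _ hbb'
    rw [Function.onFun, disjoint_left]
    intro x hx hx'
    simp only [mem_product, mem_filter] at hx hx'
    exact hbb' (sub_right_injective (hx.1.2.symm.trans hx'.1.2))

/-- A Balog–Szemerédi–Gowers theorem: a set of large additive energy has a large subset with
few differences. -/
theorem exists_subset_card_sub_le_of_addE [NeZero p] (A : Finset (ZMod p)) :
    ∃ A' ⊆ A, addE A ≤ 4 * #A ^ 2 * #A' ∧ #(A' - A') * addE A ^ 3 ≤ 4096 * #A ^ 10 := by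
  rcases Nat.eq_zero_or_pos (addE A) with hE | hE
  · exact ⟨∅, by simp, by simp [hE], by simp⟩
  obtain ⟨s, hs1, hs2⟩ := exists_popular_intersection A hE
  set S := A.filter fun a => a - s ∈ A with hS
  have hScard : #S = diffRep A s := card_filter_sub_mem A s
  rw [← hScard] at hs1 hs2
  have hSpos : 0 < #S := by
    by_contra! h
    have : #S = 0 := by lia
    simp [this] at hs1
    lia
  set badN : ZMod p → ℕ := fun a =>
    #(S.filter fun b => 32 * #A ^ 2 * diffRep A (a - b) < addE A) with hbadN
  have hsum : 8 * ∑ a ∈ S, badN a ≤ #S ^ 2 := by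
    convert hs2 using 2
    simp_rw [hbadN, card_filter]
    rw [sum_product]
  set A' := S.filter fun a => 4 * badN a ≤ #S with hA'
  have hA'card : #S ≤ 2 * #A' := by
    have h1 : #A' + #(S.filter fun a => ¬ 4 * badN a ≤ #S) = #S :=
      card_filter_add_card_filter_not _
    have h2 : #S * #(S.filter fun a => ¬ 4 * badN a ≤ #S) ≤ 4 * ∑ a ∈ S, badN a := by
      calc _ = ∑ a ∈ S.filter (fun a => ¬ 4 * badN a ≤ #S), #S := by
            rw [sum_const, smul_eq_mul, mul_comm]
        _ ≤ ∑ a ∈ S.filter (fun a => ¬ 4 * badN a ≤ #S), 4 * badN a :=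
            sum_le_sum fun a ha => by
              have := (mem_filter.1 ha).2
              lia
        _ ≤ ∑ a ∈ S, 4 * badN a := sum_le_sum_of_subset (filter_subset _ _)
        _ = _ := by rw [mul_sum]
    have h3 : #S * (2 * #(S.filter fun a => ¬ 4 * badN a ≤ #S)) ≤ #S * #S := by nlinarith
    have := Nat.le_of_mul_le_mul_left h3 hSpos
    lia
  refine ⟨A', (filter_subset _ _).trans (filter_subset _ _), ?_, ?_⟩
  · calc addE A ≤ 2 * #A ^ 2 * #S := hs1
      _ ≤ 2 * #A ^ 2 * (2 * #A') := by gcongr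
      _ = _ := by ring
  have hrep : ∀ e ∈ A' - A', #S * addE A ^ 2 ≤ 2 * (32 * #A ^ 2) ^ 2 *
      #(((A ×ˢ A) ×ˢ (A ×ˢ A)).filter fun x => (x.1.1 - x.1.2) - (x.2.1 - x.2.2) = e) := by
    intro e he
    obtain ⟨a, ha, a', ha', rfl⟩ := mem_sub.1 he
    set good := S.filter fun b => addE A ≤ 32 * #A ^ 2 * diffRep A (a - b) ∧
      addE A ≤ 32 * #A ^ 2 * diffRep A (a' - b) with hgood
    have hgc : #S ≤ 2 * #good := by
      have hsub : S ⊆ good ∪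
          (S.filter (fun b => 32 * #A ^ 2 * diffRep A (a - b) < addE A) ∪
          S.filter (fun b => 32 * #A ^ 2 * diffRep A (a' - b) < addE A)) := by
        intro b hb
        simp only [hgood, mem_union, mem_filter, hb, true_and]
        lia
      have h1 := (card_le_card hsub).trans ((card_union_le _ _).trans
        (Nat.add_le_add_left (card_union_le _ _) _))
      have h2 := (mem_filter.1 ha).2
      have h3 := (mem_filter.1 ha').2
      simp only [hbadN] at h2 h3
      lia
    calc #S * addE A ^ 2 ≤ 2 * #good * addE A ^ 2 := by gcongr
      _ = 2 * ∑ b ∈ good, addE A * addE A := by rw [sum_const, smul_eq_mul]; ring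
      _ ≤ 2 * ∑ b ∈ good, (32 * #A ^ 2 * diffRep A (a - b)) *
          (32 * #A ^ 2 * diffRep A (a' - b)) := by
        gcongr with b hb b hb
        · exact (mem_filter.1 hb).2.1
        · exact (mem_filter.1 hb).2.2
      _ = 2 * (32 * #A ^ 2) ^ 2 * ∑ b ∈ good, diffRep A (a - b) * diffRep A (a' - b) := by
        rw [mul_assoc, mul_sum, mul_sum, mul_sum]
        refine sum_congr rfl fun b _ => by ring
      _ ≤ _ := by
        gcongr
        exact sum_diffRep_mul_diffRep_le A good a a'
  have htot : #(A' - A') * (#S * addE A ^ 2) ≤ 2 * (32 * #A ^ 2) ^ 2 * #A ^ 4 := by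
    rw [← smul_eq_mul, ← sum_const]
    refine (sum_le_sum hrep).trans ?_
    rw [← mul_sum]
    gcongr
    refine (sum_le_sum_of_subset (subset_univ _)).trans ?_
    rw [← card_eq_sum_card_fiberwise (by simp)]
    simp only [card_product]
    exact le_of_eq (by ring)
  calc #(A' - A') * addE A ^ 3 = #(A' - A') * addE A ^ 2 * addE A := by ring
    _ ≤ #(A' - A') * addE A ^ 2 * (2 * #A ^ 2 * #S) := by gcongr
    _ = 2 * #A ^ 2 * (#(A' - A') * (#S * addE A ^ 2)) := by ring
    _ ≤ 2 * #A ^ 2 * (2 * (32 * #A ^ 2) ^ 2 * #A ^ 4) := by gcongr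
    _ = _ := by ring

end BalogSzemerediGowers

section Pivot

open scoped Pointwise

variable {p : ℕ} [Fact p.Prime]

/-- Some dilate gives a sumset of almost maximal size. -/
lemma exists_card_add_smul_ge (S : Finset (ZMod p)) (hS : #S ^ 2 ≤ p) :
    ∃ r : ZMod p, #S ^ 2 ≤ 2 * #(S + r • S) := by
  rcases S.eq_empty_or_nonempty with rfl | hne
  · exact ⟨0, by simp⟩
  have hpos : 0 < #S ^ 2 := by have := hne.card_pos; positivity
  set N : ZMod p → ℕ := fun r =>
    #(((S ×ˢ S) ×ˢ (S ×ˢ S)).filter fun x => x.1.1 + r * x.1.2 = x.2.1 + r * x.2.2) with hN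
  have hsum : ∑ r, N r ≤ ∑ _r : ZMod p, 2 * #S ^ 2 := by
    have hquad (x : (ZMod p × ZMod p) × (ZMod p × ZMod p)) :
        (∑ r : ZMod p, if x.1.1 + r * x.1.2 = x.2.1 + r * x.2.2 then 1 else 0) ≤
          (if x.1 = x.2 then p else 0) + 1 := by
      rw [← card_filter]
      split_ifs with hx
      · exact (card_le_univ _).trans (by rw [ZMod.card]; lia)
      · rw [zero_add, card_le_one]
        intro r hr t ht
        simp only [mem_filter, mem_univ, true_and] at hr ht
        by_contra hrt
        have h2 : x.1.2 = x.2.2 := by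
          have : (r - t) * (x.1.2 - x.2.2) = 0 := by linear_combination hr - ht
          rcases mul_eq_zero.1 this with h | h
          · exact absurd (sub_eq_zero.1 h) hrt
          · exact sub_eq_zero.1 h
        refine hx (Prod.ext ?_ h2)
        rw [h2] at hr
        exact add_right_cancel hr
    simp_rw [hN, card_filter]
    rw [sum_comm]
    refine (sum_le_sum fun x _ => hquad x).trans ?_
    rw [sum_add_distrib, ← sum_filter, sum_const, sum_const, sum_const]
    have hdiag : #(((S ×ˢ S) ×ˢ (S ×ˢ S)).filter fun x => x.1 = x.2) ≤ #S ^ 2 := by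
      rw [sq, ← card_product]
      refine card_le_card_of_injOn Prod.fst ?_ ?_
      · intro x hx
        simp only [coe_filter, mem_product, Set.mem_ofPred_eq] at hx
        simpa using hx.1.1
      · intro x hx y hy hxy
        simp only [coe_filter, mem_product, Set.mem_ofPred_eq] at hx hy
        exact Prod.ext hxy (hx.2 ▸ hy.2 ▸ hxy)
    simp only [smul_eq_mul, card_product, card_univ, ZMod.card]
    nlinarith [Nat.mul_le_mul_right p hdiag, Nat.mul_le_mul_left (#S ^ 2) hS]
  obtain ⟨r, -, hr⟩ := exists_le_of_sum_le univ_nonempty hsum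
  refine ⟨r, ?_⟩
  have h := card_sq_le_card_mul_card_collisions (S ×ˢ S) (fun x => x.1 + r * x.2) (S + r • S)
    (fun u hu => add_mem_add (mem_product.1 hu).1 (smul_mem_smul_finset (mem_product.1 hu).2))
  rw [card_product] at h
  have h' : #S ^ 2 * #S ^ 2 ≤ #S ^ 2 * (2 * #(S + r • S)) := by
    calc _ = (#S * #S) ^ 2 := by ring
      _ ≤ #(S + r • S) * N r := h
      _ ≤ #(S + r • S) * (2 * #S ^ 2) := by gcongr
      _ = _ := by ring
  exact Nat.le_of_mul_le_mul_left h' hpos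

/-- A set closed under `r ↦ r - 1` and containing `0` is everything. -/
lemma forall_of_sub_one {Q : ZMod p → Prop} (h0 : Q 0) (h : ∀ r, Q r → Q (r - 1)) (r : ZMod p) :
    Q r := by
  have hn : ∀ n : ℕ, Q (-(n : ZMod p)) := by
    intro n
    induction n with
    | zero => simpa using h0
    | succ n ih =>
      have := h _ ih
      push_cast
      convert this using 1
      ring
  have := hn (-r).val
  rwa [ZMod.natCast_zmod_val, neg_neg] at this

/-- Additive pivoting: some ratio of differences gives a large sum of dilates. -/
lemma exists_ratio_card_pow_three_le (S : Finset (ZMod p)) (hS : #S ^ 2 ≤ p) (hS1 : 1 < #S) :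
    ∃ a ∈ S, ∃ b ∈ S, ∃ c ∈ S, ∃ d ∈ S, c ≠ d ∧
      #S ^ 3 ≤ 4 * #(S - S) * #(S + ((a - b) / (c - d)) • S) := by
  set Q : ZMod p → Prop := fun r => ∃ a ∈ S, ∃ b ∈ S, ∃ c ∈ S, ∃ d ∈ S, c ≠ d ∧
    r = (a - b) / (c - d) with hQ
  suffices ∃ r, Q r ∧ #S ^ 3 ≤ 4 * #(S - S) * #(S + r • S) by
    obtain ⟨r, ⟨a, ha, b, hb, c, hc, d, hd, hcd, rfl⟩, h⟩ := this
    exact ⟨a, ha, b, hb, c, hc, d, hd, hcd, h⟩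
  obtain ⟨c, hc, d, hd, hcd⟩ := one_lt_card.1 hS1
  have hne : S.Nonempty := ⟨c, hc⟩
  have h0 : Q 0 := ⟨c, hc, c, hc, c, hc, d, hd, hcd, by simp⟩
  by_cases hall : ∀ r, Q r
  · obtain ⟨r, hr⟩ := exists_card_add_smul_ge S hS
    refine ⟨r, hall r, ?_⟩
    have : #S ≤ #(S - S) := card_le_card_sub_right hne
    calc #S ^ 3 = #S * #S ^ 2 := by ring
      _ ≤ #(S - S) * (2 * #(S + r • S)) := by gcongr
      _ ≤ _ := by nlinarith
  · obtain ⟨r, hr, hr1⟩ : ∃ r, Q r ∧ ¬ Q (r - 1) := by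
      by_contra! h
      exact hall (forall_of_sub_one h0 h)
    refine ⟨r, hr, ?_⟩
    obtain ⟨T, hTS, hT, hTC⟩ := exists_large_subset_card_add_add_le S (-S) hne.neg
    have hinj : #T * #S ≤ #(T + -S + r • S) := by
      rw [← card_product]
      refine card_le_card_of_injOn (fun x => x.1 + -x.2 + r * x.2) ?_ ?_
      · intro x hx
        simp only [coe_product, Set.mem_prod, mem_coe] at hx
        exact add_mem_add (add_mem_add hx.1 (neg_mem_neg hx.2)) (smul_mem_smul_finset hx.2)
      · rintro ⟨x, y⟩ hx ⟨z, w⟩ hz hxz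
        simp only [coe_product, Set.mem_prod, mem_coe] at hx hz hxz
        have hyw : y = w := by
          by_contra hyw
          refine hr1 ⟨z, hTS hz.1, x, hTS hx.1, y, hx.2, w, hz.2, hyw, ?_⟩
          rw [eq_div_iff (sub_ne_zero.2 hyw)]
          linear_combination hxz
        subst hyw
        refine Prod.ext ?_ rfl
        linear_combination hxz
    have h := hTC (r • S)
    rw [← sub_eq_add_neg S S] at h
    have hmono : #(T + r • S) ≤ #(S + r • S) := card_le_card (add_subset_add_right hTS)
    calc #S ^ 3 = #S * (#S * #S) := by ring
      _ ≤ #S * (2 * #T * #S) := by gcongr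
      _ = 2 * (#S * (#T * #S)) := by ring
      _ ≤ 2 * (#S * #(T + -S + r • S)) := by gcongr
      _ ≤ 2 * (2 * #(S - S) * #(T + r • S)) := by gcongr
      _ ≤ 2 * (2 * #(S - S) * #(S + r • S)) := by gcongr
      _ = _ := by ring

lemma card_add_ratio_smul_le (S : Finset (ZMod p)) {a b c d : ZMod p} (hcd : c ≠ d) :
    #(S + ((a - b) / (c - d)) • S) ≤ #(c • S - d • S + a • S - b • S) := by
  have hcd' : c - d ≠ 0 := sub_ne_zero.2 hcd
  refine card_le_card_of_injOn (fun z => (c - d) * z) ?_ ?_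
  · intro z hz
    obtain ⟨x, hx, w, hw, rfl⟩ := mem_add.1 hz
    obtain ⟨y, hy, rfl⟩ := mem_smul_finset.1 hw
    have : (c - d) * (x + ((a - b) / (c - d)) • y) = c * x - d * x + a * y - b * y := by
      rw [smul_eq_mul]
      field_simp
      ring
    simp only [this, mem_coe]
    exact sub_mem_sub (add_mem_add (sub_mem_sub (smul_mem_smul_finset hx)
      (smul_mem_smul_finset hx)) (smul_mem_smul_finset hy)) (smul_mem_smul_finset hy)
  · intro x _ y _ hxy
    exact mul_left_cancel₀ hcd' hxy

lemma smul_finset_sub_distrib (a : ZMod p) (X Y : Finset (ZMod p)) :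
    a • (X - Y) = a • X - a • Y :=
  image_image₂_distrib fun x y => smul_sub a x y

lemma smul_finset_add_distrib (a : ZMod p) (X Y : Finset (ZMod p)) :
    a • (X + Y) = a • X + a • Y :=
  image_image₂_distrib fun x y => smul_add a x y

/-- Replacing the dilate `a • S` by `b • P` in a sum, when `a • P` and `b • P` meet a lot. -/
lemma card_add_smul_mul_le {P S : Finset (ZMod p)} (hS : S ⊆ P) (a b : ZMod p)
    (U : Finset (ZMod p)) :
    #(U + a • S) * #(a • P ∩ b • P) ≤ #(P - P) * #(U + b • P) := by
  have h := ruzsa_triangle_inequality_add_sub_add (a • S) (a • P ∩ b • P) U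
  have h1 : #((a • P ∩ b • P) - a • S) ≤ #(P - P) := by
    refine (card_le_card
      (sub_subset_sub inter_subset_left (smul_finset_subset_smul_finset hS))).trans ?_
    rw [← smul_finset_sub_distrib]
    exact card_image_le
  have h2 : #((a • P ∩ b • P) + U) ≤ #(U + b • P) := by
    rw [add_comm]
    exact card_le_card (add_subset_add_left inter_subset_right)
  rw [mul_comm, add_comm U]
  exact h.trans (Nat.mul_le_mul h1 h2)

lemma card_sub_smul_mul_le {P S : Finset (ZMod p)} (hS : S ⊆ P) (a b : ZMod p)
    (U : Finset (ZMod p)) :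
    #(U - a • S) * #(a • P ∩ b • P) ≤ #(P - P) * #(U - b • P) := by
  have h := ruzsa_triangle_inequality_sub_sub_sub U (a • P ∩ b • P) (a • S)
  have h1 : #(a • S - (a • P ∩ b • P)) ≤ #(P - P) := by
    refine (card_le_card
      (sub_subset_sub (smul_finset_subset_smul_finset hS) inter_subset_left)).trans ?_
    rw [← smul_finset_sub_distrib]
    exact card_image_le
  have h2 : #(U - (a • P ∩ b • P)) ≤ #(U - b • P) :=
    card_le_card (sub_subset_sub_left inter_subset_right)
  rw [mul_comm #(P - P)]
  exact h.trans (Nat.mul_le_mul h2 h1)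

lemma card_two_sub_two_mul_le (P : Finset (ZMod p)) :
    #(2 • P - 2 • P) * #P ^ 3 ≤ #(P - P) ^ 4 := by
  rcases P.eq_empty_or_nonempty with rfl | hP
  · simp
  have h := pluennecke_ruzsa_inequality_nsmul_sub_nsmul_sub hP P 2 2
  have hpos : (0 : ℚ≥0) < #P := by exact_mod_cast hP.card_pos
  have h' : (#(2 • P - 2 • P) : ℚ≥0) * #P ^ 3 ≤ #(P - P) ^ 4 := by
    calc _ ≤ ((#(P - P) / #P : ℚ≥0) ^ (2 + 2) * #P) * #P ^ 3 := by gcongr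
      _ = _ := by
        rw [div_pow]
        field_simp
        ring
  exact_mod_cast h'

lemma card_dilates_mul_pow_le {P S : Finset (ZMod p)} (hS : S ⊆ P) {a b c d t : ZMod p} {N M : ℕ}
    (ha : N ≤ M * #(a • P ∩ t • P)) (hb : N ≤ M * #(b • P ∩ t • P))
    (hc : N ≤ M * #(c • P ∩ t • P)) (hd : N ≤ M * #(d • P ∩ t • P)) :
    #(c • S - d • S + a • S - b • S) * N ^ 4 ≤ (M * #(P - P)) ^ 4 * #(2 • P - 2 • P) := by
  have key {u v x y : ℕ} (hx : N ≤ M * x) (h : u * x ≤ y * v) : u * N ≤ M * y * v := by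
    calc u * N ≤ u * (M * x) := by gcongr
      _ = M * (u * x) := by ring
      _ ≤ M * (y * v) := by gcongr
      _ = _ := by ring
  have h1 := key hb (card_sub_smul_mul_le hS b t (c • S - d • S + a • S))
  have e1 : c • S - d • S + a • S - t • P = (c • S - d • S - t • P) + a • S := by
    rw [add_sub_right_comm]
  rw [e1] at h1
  have h2 := key ha (card_add_smul_mul_le hS a t (c • S - d • S - t • P))
  have e2 : c • S - d • S - t • P + t • P = (c • S - t • P + t • P) - d • S := by
    rw [sub_right_comm, sub_add_eq_add_sub]
  rw [e2] at h2
  have h3 := key hd (card_sub_smul_mul_le hS d t (c • S - t • P + t • P))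
  have e3 : c • S - t • P + t • P - t • P = (t • P - t • P - t • P) + c • S := by
    simp only [sub_eq_add_neg]
    ac_rfl
  rw [e3] at h3
  have h4 := key hc (card_add_smul_mul_le hS c t (t • P - t • P - t • P))
  have h5 : #(t • P - t • P - t • P + t • P) ≤ #(2 • P - 2 • P) := by
    have : t • P - t • P - t • P + t • P = t • (2 • P - 2 • P) := by
      rw [smul_finset_sub_distrib, two_nsmul, smul_finset_add_distrib, ← sub_sub,
        sub_add_eq_add_sub, sub_add_eq_add_sub]
    rw [this]
    exact card_image_le
  set D := #(P - P)
  calc _ ≤ _ * N * N ^ 3 := le_of_eq (by ring)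
    _ ≤ _ := Nat.mul_le_mul_right _ h1
    _ = (M * D) * (_ * N) * N ^ 2 := by ring
    _ ≤ _ := Nat.mul_le_mul_right _ (Nat.mul_le_mul_left _ h2)
    _ = (M * D) ^ 2 * (_ * N) * N := by ring
    _ ≤ _ := Nat.mul_le_mul_right _ (Nat.mul_le_mul_left _ h3)
    _ = (M * D) ^ 3 * (_ * N) := by ring
    _ ≤ _ := Nat.mul_le_mul_left _ h4
    _ ≤ (M * D) ^ 3 * (M * D * #(2 • P - 2 • P)) := by gcongr
    _ = _ := by ring

/-- The number of coincidences between `a • P` and `b • P`. -/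
lemma card_filter_mul_eq_mul_le (P : Finset (ZMod p)) {a b : ZMod p} (ha : a ≠ 0) (hb : b ≠ 0) :
    #((P ×ˢ P).filter fun x => a * x.1 = b * x.2) ≤ #(a • P ∩ b • P) := by
  refine card_le_card_of_injOn (fun x => a * x.1) ?_ ?_
  · intro x hx
    simp only [coe_filter, mem_product, Set.mem_ofPred_eq] at hx
    refine mem_inter.2 ⟨smul_mem_smul_finset hx.1.1, ?_⟩
    change a * x.1 ∈ b • P
    rw [hx.2]
    exact smul_mem_smul_finset hx.1.2
  · intro x hx y hy hxy
    simp only [coe_filter, mem_product, Set.mem_ofPred_eq] at hx hy hxy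
    refine Prod.ext (mul_left_cancel₀ ha hxy) (mul_left_cancel₀ hb ?_)
    rw [← hx.2, ← hy.2, hxy]

lemma mulE_le_sum_card_inter (P : Finset (ZMod p)) (h0 : 0 ∉ P) :
    mulE P ≤ ∑ b ∈ P, ∑ a ∈ P, #(a • P ∩ b • P) := by
  have h : mulE P = ∑ b ∈ P, ∑ a ∈ P, #((P ×ˢ P).filter fun x => a * x.1 = b * x.2) := by
    simp_rw [mulE, card_filter, sum_product]
    symm
    rw [sum_comm]
    refine sum_congr rfl fun a _ => ?_
    rw [sum_comm]
  rw [h]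
  refine sum_le_sum fun b hb => sum_le_sum fun a ha => ?_
  exact card_filter_mul_eq_mul_le P (ne_of_mem_of_not_mem ha h0) (ne_of_mem_of_not_mem hb h0)

/-- A set with few differences has small multiplicative energy. -/
theorem mulE_pow_seven_le (P : Finset (ZMod p)) (h0 : 0 ∉ P) (hP : #P ^ 2 ≤ p) :
    mulE P ^ 7 ≤ 512 * #(P - P) ^ 9 * #P ^ 11 := by
  rcases P.eq_empty_or_nonempty with rfl | hne
  · simp [mulE]
  have hm : 0 < #P := hne.card_pos
  have hD : #P ≤ #(P - P) := card_le_card_sub_right hne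
  obtain ⟨t, htP, ht⟩ : ∃ t ∈ P, mulE P ≤ #P * ∑ a ∈ P, #(a • P ∩ t • P) := by
    by_contra! h
    have h1 := mulE_le_sum_card_inter P h0
    have h2 := sum_lt_sum_of_nonempty hne h
    rw [← mul_sum, sum_const, smul_eq_mul] at h2
    have := Nat.mul_le_mul_left #P h1
    lia
  set S := P.filter fun a => mulE P ≤ 2 * #P ^ 2 * #(a • P ∩ t • P) with hS
  have hSP : S ⊆ P := filter_subset _ _
  have hScard : mulE P ≤ 2 * #P ^ 2 * #S := by
    have h1 : ∀ a ∈ P, 2 * #P ^ 2 * #(a • P ∩ t • P) ≤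
        mulE P + if mulE P ≤ 2 * #P ^ 2 * #(a • P ∩ t • P) then 2 * #P ^ 3 else 0 := by
      intro a _
      split_ifs with h
      · have : #(a • P ∩ t • P) ≤ #P := (card_le_card inter_subset_left).trans card_image_le
        calc _ ≤ 2 * #P ^ 2 * #P := by gcongr
          _ = 2 * #P ^ 3 := by ring
          _ ≤ _ := by lia
      · lia
    have h2 := sum_le_sum h1
    rw [← mul_sum, sum_add_distrib, sum_const, ← sum_filter, sum_const, smul_eq_mul,
      smul_eq_mul] at h2
    rw [← hS] at h2
    have h3 := Nat.mul_le_mul_left (2 * #P) ht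
    refine Nat.le_of_mul_le_mul_left ?_ hm
    nlinarith
  rcases Nat.lt_or_ge 1 #S with hS1 | hS1
  · obtain ⟨a, ha, b, hb, c, hc, d, hd, hcd, h⟩ := exists_ratio_card_pow_three_le S
      ((Nat.pow_le_pow_left (card_le_card hSP) 2).trans hP) hS1
    have h1 := card_add_ratio_smul_le S (a := a) (b := b) hcd
    have h2 := card_dilates_mul_pow_le hSP (mem_filter.1 ha).2 (mem_filter.1 hb).2
      (mem_filter.1 hc).2 (mem_filter.1 hd).2
    have h3 := card_two_sub_two_mul_le P
    have h4 : #(S - S) ≤ #(P - P) := card_le_card (sub_subset_sub hSP hSP)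
    set W := #(c • S - d • S + a • S - b • S)
    set D := #(P - P)
    set E := mulE P
    have h5 : E ^ 7 * #P ^ 3 ≤ (512 * D ^ 9 * #P ^ 11) * #P ^ 3 := by
      calc E ^ 7 * #P ^ 3 = E ^ 3 * E ^ 4 * #P ^ 3 := by ring
        _ ≤ (2 * #P ^ 2 * #S) ^ 3 * E ^ 4 * #P ^ 3 := by gcongr
        _ = 8 * #P ^ 6 * #S ^ 3 * E ^ 4 * #P ^ 3 := by ring
        _ ≤ 8 * #P ^ 6 * (4 * D * W) * E ^ 4 * #P ^ 3 := by
          gcongr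
          exact h.trans (by gcongr)
        _ = 32 * #P ^ 6 * D * (W * E ^ 4) * #P ^ 3 := by ring
        _ ≤ 32 * #P ^ 6 * D * ((2 * #P ^ 2 * D) ^ 4 * #(2 • P - 2 • P)) * #P ^ 3 := by gcongr
        _ = 512 * #P ^ 14 * D ^ 5 * (#(2 • P - 2 • P) * #P ^ 3) := by ring
        _ ≤ 512 * #P ^ 14 * D ^ 5 * D ^ 4 := by gcongr
        _ = _ := by ring
    exact Nat.le_of_mul_le_mul_right h5 (by positivity)
  · calc mulE P ^ 7 ≤ (2 * #P ^ 2 * 1) ^ 7 := by gcongr; exact hScard.trans (by gcongr)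
      _ = 128 * #P ^ 3 * #P ^ 11 := by ring
      _ ≤ 512 * #(P - P) ^ 9 * #P ^ 11 := by
        have h3 : #P ^ 3 ≤ #(P - P) ^ 9 := by
          calc #P ^ 3 ≤ #(P - P) ^ 3 := Nat.pow_le_pow_left hD 3
            _ ≤ #(P - P) ^ 9 := Nat.pow_le_pow_right (hm.trans_le hD) (by norm_num)
        exact Nat.mul_le_mul_right _ (Nat.mul_le_mul (by norm_num) h3)

end Pivot

section Decomposition

open scoped Pointwise

variable {p : ℕ} [Fact p.Prime]

/-- The number of representations of `d` as a quotient of an element of `X` by one of `Y`. -/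
def quotRep (X Y : Finset (ZMod p)) (d : ZMod p) : ℕ :=
  #((X ×ˢ Y).filter fun x => x.1 / x.2 = d)

lemma mulE_eq_sum_quotRep_sq (X : Finset (ZMod p)) (hX : 0 ∉ X) :
    mulE X = ∑ d, quotRep X X d ^ 2 := by
  simp_rw [sq]
  unfold quotRep
  rw [← card_filter_product_eq_sum (X ×ˢ X) (X ×ˢ X) (fun x => x.1 / x.2) (fun x => x.1 / x.2)]
  refine card_nbij' (fun x => ((x.1, x.2.2.1), (x.2.2.2, x.2.1)))
    (fun x => (x.1.1, x.2.2, x.1.2, x.2.1)) ?_ ?_ (fun _ _ => rfl) (fun _ _ => rfl)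
  · rintro ⟨a, b, c, d⟩ h
    simp only [coe_filter, mem_product, Set.mem_ofPred_eq] at h ⊢
    refine ⟨by tauto, ?_⟩
    rw [div_eq_div_iff (ne_of_mem_of_not_mem h.1.2.2.1 hX) (ne_of_mem_of_not_mem h.1.2.1 hX)]
    linear_combination h.2
  · rintro ⟨⟨a, b⟩, c, d⟩ h
    simp only [coe_filter, mem_product, Set.mem_ofPred_eq] at h ⊢
    refine ⟨by tauto, ?_⟩
    have h2 := h.2
    rw [div_eq_div_iff (ne_of_mem_of_not_mem h.1.1.2 hX) (ne_of_mem_of_not_mem h.1.2.2 hX)] at h2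
    linear_combination h2

lemma sum_quotRep_sq_le (X Y : Finset (ZMod p)) (hX : 0 ∉ X) (hY : 0 ∉ Y) :
    2 * ∑ d, quotRep X Y d ^ 2 ≤ mulE X + mulE Y := by
  have h : ∑ d, quotRep X Y d ^ 2 = ∑ d, quotRep X X d * quotRep Y Y d := by
    simp_rw [sq]
    unfold quotRep
    rw [← card_filter_product_eq_sum (X ×ˢ Y) (X ×ˢ Y) (fun x => x.1 / x.2) (fun x => x.1 / x.2),
      ← card_filter_product_eq_sum (X ×ˢ X) (Y ×ˢ Y) (fun x => x.1 / x.2) (fun x => x.1 / x.2)]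
    refine card_nbij' (fun x => ((x.1.1, x.2.1), (x.1.2, x.2.2)))
      (fun x => ((x.1.1, x.2.1), (x.1.2, x.2.2))) ?_ ?_ (fun _ _ => rfl) (fun _ _ => rfl)
    · rintro ⟨⟨a, b⟩, c, d⟩ h
      simp only [coe_filter, mem_product, Set.mem_ofPred_eq] at h ⊢
      refine ⟨by tauto, ?_⟩
      have h2 := h.2
      rw [div_eq_div_iff (ne_of_mem_of_not_mem h.1.1.2 hY) (ne_of_mem_of_not_mem h.1.2.2 hY)] at h2
      rw [div_eq_div_iff (ne_of_mem_of_not_mem h.1.2.1 hX) (ne_of_mem_of_not_mem h.1.2.2 hY)]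
      linear_combination h2
    · rintro ⟨⟨a, b⟩, c, d⟩ h
      simp only [coe_filter, mem_product, Set.mem_ofPred_eq] at h ⊢
      refine ⟨by tauto, ?_⟩
      have h2 := h.2
      rw [div_eq_div_iff (ne_of_mem_of_not_mem h.1.1.2 hX) (ne_of_mem_of_not_mem h.1.2.2 hY)] at h2
      rw [div_eq_div_iff (ne_of_mem_of_not_mem h.1.2.1 hY) (ne_of_mem_of_not_mem h.1.2.2 hY)]
      linear_combination h2
  rw [h, mulE_eq_sum_quotRep_sq X hX, mulE_eq_sum_quotRep_sq Y hY, mul_sum, ← sum_add_distrib]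
  exact sum_le_sum fun d _ => by nlinarith [two_mul_le_add_sq (quotRep X X d) (quotRep Y Y d)]

lemma quotRep_biUnion_le (F : Finset (Finset (ZMod p))) (d : ZMod p) :
    quotRep (F.biUnion id) (F.biUnion id) d ≤ ∑ x ∈ F ×ˢ F, quotRep x.1 x.2 d := by
  unfold quotRep
  refine le_trans (card_le_card fun z hz => ?_) card_biUnion_le
  simp only [mem_biUnion, mem_filter, mem_product, id] at hz ⊢
  obtain ⟨⟨⟨X, hX, hzX⟩, Y, hY, hzY⟩, hz⟩ := hz
  exact ⟨(X, Y), ⟨hX, hY⟩, ⟨hzX, hzY⟩, hz⟩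

/-- Multiplicative energy of a union of `k` sets of multiplicative energy at most `W`. -/
lemma mulE_biUnion_le (F : Finset (Finset (ZMod p))) (W : ℕ)
    (hF : ∀ X ∈ F, 0 ∉ X ∧ mulE X ≤ W) : mulE (F.biUnion id) ≤ #F ^ 4 * W := by
  rw [mulE_eq_sum_quotRep_sq _ (by simpa using fun X hX => (hF X hX).1)]
  calc ∑ d, quotRep (F.biUnion id) (F.biUnion id) d ^ 2
      ≤ ∑ d, (∑ x ∈ F ×ˢ F, quotRep x.1 x.2 d) ^ 2 := by
        gcongr with d
        exact quotRep_biUnion_le F d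
    _ ≤ ∑ d, #(F ×ˢ F) * ∑ x ∈ F ×ˢ F, quotRep x.1 x.2 d ^ 2 := by
        gcongr with d
        exact sq_sum_le_card_mul_sum_sq
    _ = #(F ×ˢ F) * ∑ x ∈ F ×ˢ F, ∑ d, quotRep x.1 x.2 d ^ 2 := by
        rw [← mul_sum, sum_comm]
    _ ≤ #(F ×ˢ F) * ∑ _x ∈ F ×ˢ F, W := by
        gcongr with x hx
        obtain ⟨h1, h2⟩ := mem_product.1 hx
        have := sum_quotRep_sq_le x.1 x.2 (hF _ h1).1 (hF _ h2).1
        have := (hF _ h1).2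
        have := (hF _ h2).2
        lia
    _ = #F ^ 4 * W := by
        rw [sum_const, smul_eq_mul, card_product]
        ring

/-- Repeatedly removing pieces with few differences leaves a set of small additive energy. -/
lemma exists_decomposition_pieces (n q : ℕ) (T : ℝ) (hT : 0 < T) (hq : 0 < q)
    (hqT : ∀ m : ℕ, T ≤ 4 * (n : ℝ) ^ 2 * m → q ≤ m) (A : Finset (ZMod p)) (hA : #A ≤ n) :
    ∃ (B : Finset (ZMod p)) (F : Finset (Finset (ZMod p))), Disjoint B (F.biUnion id) ∧
      B ∪ F.biUnion id = A ∧ (addE B : ℝ) ≤ T ∧ #F * q ≤ #A ∧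
      ∀ X ∈ F, #X = q ∧ (#(X - X) : ℝ) * T ^ 3 ≤ 4096 * (n : ℝ) ^ 10 := by
  induction A using Finset.strongInduction with
  | H A ih =>
  rcases le_or_gt (addE A : ℝ) T with hE | hE
  · exact ⟨A, ∅, by simp, by simp, hE, by simp, by simp⟩
  obtain ⟨A', hA'A, h1, h2⟩ := exists_subset_card_sub_le_of_addE A
  have hAn : (#A : ℝ) ≤ n := by exact_mod_cast hA
  have hqA' : q ≤ #A' := by
    refine hqT _ ?_
    have h1' : (addE A : ℝ) ≤ 4 * (#A : ℝ) ^ 2 * #A' := by exact_mod_cast h1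
    exact hE.le.trans (h1'.trans (by gcongr))
  obtain ⟨X, hXA', hXq⟩ := exists_subset_card_eq hqA'
  have hXA := hXA'.trans hA'A
  have hXne : X.Nonempty := card_pos.1 (hXq ▸ hq)
  have hlt : A \ X ⊂ A := sdiff_ssubset hXA hXne
  obtain ⟨B, F, hBF, hU, hB, hF, hpieces⟩ := ih (A \ X) hlt ((card_le_card hlt.subset).trans hA)
  have hXF : Disjoint X (A \ X) := disjoint_sdiff
  have hBX : Disjoint B X := (hXF.mono_right (hU ▸ subset_union_left)).symm
  have hX : X ∉ F := by
    intro h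
    have : X ⊆ A \ X := (subset_biUnion_of_mem id h).trans (hU ▸ subset_union_right)
    exact hXne.ne_empty (disjoint_self.1 (hXF.mono_right this))
  refine ⟨B, insert X F, ?_, ?_, hB, ?_, ?_⟩
  · rw [biUnion_insert, disjoint_union_right]
    exact ⟨hBX, hBF⟩
  · rw [biUnion_insert, union_left_comm, hU]
    exact union_sdiff_of_subset hXA
  · rw [card_insert_of_notMem hX]
    have := card_sdiff_add_card_eq_card hXA
    lia
  · intro Y hY
    rcases mem_insert.1 hY with rfl | hY
    · refine ⟨hXq, ?_⟩
      have h2' : (#(A' - A') : ℝ) * (addE A : ℝ) ^ 3 ≤ 4096 * (#A : ℝ) ^ 10 := by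
        exact_mod_cast h2
      have h3 : (#(Y - Y) : ℝ) ≤ #(A' - A') := by
        exact_mod_cast card_le_card (sub_subset_sub hXA' hXA')
      calc _ ≤ (#(A' - A') : ℝ) * (addE A : ℝ) ^ 3 := by gcongr
        _ ≤ _ := h2'
        _ ≤ _ := by gcongr
    · exact hpieces Y hY

lemma addE_insert_zero_le (B : Finset (ZMod p)) :
    addE (insert 0 B) ≤ addE B + 4 * (#B + 1) ^ 2 := by
  set Z := insert 0 B with hZ
  have hZc : #Z ≤ #B + 1 := card_insert_le _ _
  set f : Fin 4 → (ZMod p × ZMod p) → ZMod p × ZMod p × ZMod p × ZMod p :=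
    ![fun x => (0, x.1 + x.2, x.1, x.2), fun x => (x.1 + x.2, 0, x.1, x.2),
      fun x => (x.1, x.2, 0, x.1 + x.2), fun x => (x.1, x.2, x.1 + x.2, 0)] with hf
  have hsub : ((Z ×ˢ Z ×ˢ Z ×ˢ Z).filter fun x => x.1 + x.2.1 = x.2.2.1 + x.2.2.2) ⊆
      ((B ×ˢ B ×ˢ B ×ˢ B).filter fun x => x.1 + x.2.1 = x.2.2.1 + x.2.2.2) ∪
        univ.biUnion fun i => (Z ×ˢ Z).image (f i) := by
    rintro ⟨a, b, c, d⟩ h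
    simp only [mem_filter, mem_product] at h
    obtain ⟨⟨ha, hb, hc, hd⟩, h⟩ := h
    simp only [mem_union, mem_filter, mem_product, mem_biUnion, mem_univ, true_and, mem_image]
    by_cases h0 : a = 0
    · exact Or.inr ⟨0, (c, d), ⟨hc, hd⟩, by simp [hf, h0, ← h]⟩
    by_cases h1 : b = 0
    · exact Or.inr ⟨1, (c, d), ⟨hc, hd⟩, by simp [hf, h1, ← h]⟩
    by_cases h2 : c = 0
    · exact Or.inr ⟨2, (a, b), ⟨ha, hb⟩, by simp [hf, h2, h]⟩
    by_cases h3 : d = 0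
    · exact Or.inr ⟨3, (a, b), ⟨ha, hb⟩, by simp [hf, h3, h]⟩
    exact Or.inl ⟨⟨mem_of_mem_insert_of_ne ha h0, mem_of_mem_insert_of_ne hb h1,
      mem_of_mem_insert_of_ne hc h2, mem_of_mem_insert_of_ne hd h3⟩, h⟩
  refine (card_le_card hsub).trans ((card_union_le _ _).trans (Nat.add_le_add_left ?_ _))
  calc _ ≤ ∑ i : Fin 4, #((Z ×ˢ Z).image (f i)) := card_biUnion_le
    _ ≤ ∑ _i : Fin 4, (#B + 1) ^ 2 := by
      gcongr with i
      refine card_image_le.trans ?_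
      rw [card_product, sq]
      gcongr
    _ = _ := by simp

lemma mulE_biUnion_pieces_pow_le {n q : ℕ} {T : ℝ} (hT : 0 < T) (hq : T ≤ 4 * (n : ℝ) ^ 2 * q)
    (hTn : (n : ℝ) ^ 152 ≤ T ^ 51) (hnp : n ^ 2 ≤ p) (F : Finset (Finset (ZMod p)))
    (hFq : #F * q ≤ n) (hF : ∀ X ∈ F, 0 ∉ X ∧ #X = q ∧
      (#(X - X) : ℝ) * T ^ 3 ≤ 4096 * (n : ℝ) ^ 10) :
    (mulE (F.biUnion id) : ℝ) ^ 7 ≤ 512 * 4096 ^ 9 * 4 ^ 17 * T ^ 7 := by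
  rcases F.eq_empty_or_nonempty with rfl | hne
  · simp [mulE]
    positivity
  obtain ⟨Y, hY, hmax⟩ := exists_max_image F mulE hne
  have hU := mulE_biUnion_le F (mulE Y) fun X hX => ⟨(hF X hX).1, hmax X hX⟩
  obtain ⟨hY0, hYq, hYD⟩ := hF Y hY
  have hk : 0 < #F := hne.card_pos
  have hqn : q ≤ n := (Nat.le_mul_of_pos_left q hk).trans hFq
  have hE := mulE_pow_seven_le Y hY0 (by rw [hYq]; exact (Nat.pow_le_pow_left hqn 2).trans hnp)
  rw [hYq] at hE
  have hU' : (mulE (F.biUnion id) : ℝ) ≤ (#F : ℝ) ^ 4 * mulE Y := by exact_mod_cast hU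
  have hE' : (mulE Y : ℝ) ^ 7 ≤ 512 * (#(Y - Y) : ℝ) ^ 9 * (q : ℝ) ^ 11 := by exact_mod_cast hE
  have hFq' : (#F : ℝ) * q ≤ n := by exact_mod_cast hFq
  have hmain : (mulE (F.biUnion id) : ℝ) ^ 7 * T ^ 44 ≤
      (512 * 4096 ^ 9 * 4 ^ 17 * T ^ 7) * T ^ 44 := by
    calc (mulE (F.biUnion id) : ℝ) ^ 7 * T ^ 44
        ≤ ((#F : ℝ) ^ 4 * mulE Y) ^ 7 * T ^ 44 := by gcongr
      _ = (#F : ℝ) ^ 28 * (mulE Y : ℝ) ^ 7 * T ^ 44 := by ring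
      _ ≤ (#F : ℝ) ^ 28 * (512 * (#(Y - Y) : ℝ) ^ 9 * (q : ℝ) ^ 11) * T ^ 44 := by gcongr
      _ = 512 * (#F : ℝ) ^ 28 * (q : ℝ) ^ 11 * (#(Y - Y) * T ^ 3) ^ 9 * T ^ 17 := by ring
      _ ≤ 512 * (#F : ℝ) ^ 28 * (q : ℝ) ^ 11 * (4096 * (n : ℝ) ^ 10) ^ 9 *
          (4 * (n : ℝ) ^ 2 * q) ^ 17 := by gcongr
      _ = 512 * 4096 ^ 9 * 4 ^ 17 * (#F * q : ℝ) ^ 28 * (n : ℝ) ^ 124 := by ring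
      _ ≤ 512 * 4096 ^ 9 * 4 ^ 17 * (n : ℝ) ^ 28 * (n : ℝ) ^ 124 :=
        mul_le_mul_of_nonneg_right (mul_le_mul_of_nonneg_left
          (pow_le_pow_left₀ (by positivity) hFq' 28) (by positivity)) (pow_nonneg (Nat.cast_nonneg n) 124)
      _ = 512 * 4096 ^ 9 * 4 ^ 17 * (n : ℝ) ^ 152 := by ring
      _ ≤ 512 * 4096 ^ 9 * 4 ^ 17 * T ^ 51 := by gcongr
      _ = _ := by ring
  exact le_of_mul_le_mul_right hmain (by positivity)

/-- The decomposition with an arbitrary admissible energy threshold `T`. -/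
theorem exists_low_energy_decomposition (A : Finset (ZMod p)) (hA : 0 < #A) (hAp : #A ^ 2 ≤ p)
    (T : ℝ) (hT : (#A : ℝ) ^ 2 ≤ T) (hTn : (#A : ℝ) ^ 152 ≤ T ^ 51) :
    ∃ B C : Finset (ZMod p), Disjoint B C ∧ B ∪ C = A ∧ (addE B : ℝ) ≤ 17 * T ∧
      (mulE C : ℝ) ≤ 2 ^ 22 * T := by
  set n := #A with hn
  have hn0 : (0 : ℝ) < n := by exact_mod_cast hA
  have hT0 : 0 < T := lt_of_lt_of_le (by positivity) hT
  set q := ⌈T / (4 * (n : ℝ) ^ 2)⌉₊ with hq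
  have hq0 : 0 < q := Nat.ceil_pos.2 (by positivity)
  have hqT : T ≤ 4 * (n : ℝ) ^ 2 * q := by
    rw [mul_comm, ← div_le_iff₀ (by positivity)]
    exact Nat.le_ceil _
  obtain ⟨B, F, hBF, hU, hB, hFq, hF⟩ := exists_decomposition_pieces n q T hT0 hq0
    (fun m hm => Nat.ceil_le.2 ((div_le_iff₀ (by positivity)).2 (by rwa [mul_comm])))
    (A.erase 0) (card_le_card (erase_subset _ _))
  have hFA : F.biUnion id ⊆ A.erase 0 := hU ▸ subset_union_right
  have hBA : B ⊆ A.erase 0 := hU ▸ subset_union_left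
  have hmul : (mulE (F.biUnion id) : ℝ) ≤ 2 ^ 22 * T := by
    have h := mulE_biUnion_pieces_pow_le hT0 hqT hTn hAp F
      (hFq.trans (card_le_card (erase_subset _ _))) fun X hX =>
        ⟨fun h0 => notMem_erase 0 A (hFA (mem_biUnion.2 ⟨X, hX, h0⟩)), hF X hX⟩
    refine le_of_pow_le_pow_left₀ (n := 7) (by norm_num) (by positivity) (h.trans ?_)
    rw [mul_pow]
    gcongr
    norm_num
  by_cases h0 : 0 ∈ A
  · refine ⟨insert 0 B, F.biUnion id, ?_, ?_, ?_, hmul⟩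
    · rw [disjoint_insert_left]
      exact ⟨fun h => notMem_erase 0 A (hFA h), hBF⟩
    · rw [insert_union, hU, insert_erase h0]
    · have h1 : (addE (insert 0 B) : ℝ) ≤ addE B + 4 * ((#B : ℝ) + 1) ^ 2 := by
        exact_mod_cast addE_insert_zero_le B
      have h2 : (#B : ℝ) ≤ n := by
        exact_mod_cast card_le_card (hBA.trans (erase_subset _ _))
      have h3 : (1 : ℝ) ≤ n := by exact_mod_cast hA
      have h4 : ((#B : ℝ) + 1) ^ 2 ≤ (n + n) ^ 2 := by gcongr
      nlinarith
  · rw [erase_eq_of_notMem h0] at hU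
    exact ⟨B, F.biUnion id, hBF, hU, by linarith, hmul⟩

end Decomposition

/-- Theorem 4.2, first part: low-energy decompositions in `𝔽_p` for `|A| < √p`,
with `δ = 4/227`. -/
theorem low_energy_decomposition_Fp_sqrt_small :
    ∃ K : ℝ, 0 < K ∧ ∃ p₀ : ℕ, ∀ p : ℕ, p.Prime → p₀ ≤ p →
      ∀ A : Finset (ZMod p), 2 ≤ A.card → (A.card : ℝ) < Real.sqrt p →
        ∃ B C : Finset (ZMod p), Disjoint B C ∧ B ∪ C = A ∧
          (max (addE B) (mulE C) : ℝ) ≤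
            K * (A.card : ℝ) ^ ((3 : ℝ) - 4 / 227) *
              Real.log A.card ^ ((1 : ℝ) + (4 / 227) / 2) := by
  have hlog2 : 0 < Real.log 2 := Real.log_pos (by norm_num)
  set L : ℝ := Real.log 2 ^ ((1 : ℝ) + (4 / 227) / 2) with hL
  have hL0 : 0 < L := Real.rpow_pos_of_pos hlog2 _
  refine ⟨2 ^ 22 / L, by positivity, 0, fun p hp _ A hA2 hAp => ?_⟩
  have : Fact p.Prime := ⟨hp⟩
  have hn2 : (2 : ℝ) ≤ A.card := by exact_mod_cast hA2
  have hsq : A.card ^ 2 ≤ p := by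
    have := (Real.lt_sqrt (Nat.cast_nonneg _)).1 hAp
    exact_mod_cast this.le
  set n : ℝ := (A.card : ℝ) with hn
  have hn1 : (1 : ℝ) ≤ n := by linarith
  have hn0 : (0 : ℝ) ≤ n := by linarith
  set T : ℝ := n ^ ((3 : ℝ) - 4 / 227) with hT
  have hT0 : 0 < T := Real.rpow_pos_of_pos (by linarith) _
  have hT2 : n ^ 2 ≤ T := by
    rw [← Real.rpow_natCast]
    exact Real.rpow_le_rpow_of_exponent_le hn1 (by norm_num)
  have hT51 : n ^ 152 ≤ T ^ 51 := by
    rw [← Real.rpow_natCast, hT, ← Real.rpow_mul_natCast hn0]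
    exact Real.rpow_le_rpow_of_exponent_le hn1 (by norm_num)
  obtain ⟨B, C, hBC, hU, hB, hC⟩ :=
    exists_low_energy_decomposition A (by lia) hsq T hT2 hT51
  refine ⟨B, C, hBC, hU, ?_⟩
  have hlog : L ≤ Real.log n ^ ((1 : ℝ) + (4 / 227) / 2) :=
    Real.rpow_le_rpow hlog2.le (Real.log_le_log (by norm_num) hn2) (by norm_num)
  calc _ ≤ 2 ^ 22 * T := max_le (by linarith) hC
    _ = 2 ^ 22 / L * T * L := by field_simp
    _ ≤ _ := by gcongr
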